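/- arXiv:1911.00579 — 2 statements merged into one kernel-verified Lean document; each statement's English description precedes it below -/
import Mathlib

section
/- Let A = [a_ij] and B = [b_ij] be n×n real symmetric matrices with a_ij ≠ 0 and b_ij ≠ 0 for all i, j, and suppose the matrix [a_ij / b_ij] is a correlation matrix. Then for every positive integer k and every n×n real symmetric matrix X, the Hadamard product B^{(-k)} ∘ X is majorized by A^{(-k)} ∘ X, where A^{(-k)} = [a_ij^{-k}] and B^{(-k)} = [b_ij^{-k}] denote entrywise (-k)-th powers. -/
open Matrix

/-- `v` is majorized by `w`: for every `k`, the sum of the `k` largest entries of `v`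
is at most the sum of the `k` largest entries of `w`, with equality for `k = n`.
Stated equivalently: every subset sum of `v` is dominated by some subset sum of `w`
of the same cardinality, and the total sums agree. -/
def VecMajorizedBy {ι : Type*} [Fintype ι] (v w : ι → ℝ) : Prop :=
  (∀ s : Finset ι, ∃ t : Finset ι, t.card = s.card ∧ ∑ i ∈ s, v i ≤ ∑ i ∈ t, w i) ∧
    ∑ i, v i = ∑ i, w i

/-- `X` is majorized by `Y`: both are (real) symmetric and the eigenvalue vector of `X`
is majorized by the eigenvalue vector of `Y`. -/
def MatMajorizedBy {ι : Type*} [Fintype ι] [DecidableEq ι]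
    (X Y : Matrix ι ι ℝ) : Prop :=
  ∃ (hX : X.IsHermitian) (hY : Y.IsHermitian),
    VecMajorizedBy hX.eigenvalues hY.eigenvalues

lemma aux_spectral {n : ℕ} {Y : Matrix (Fin n) (Fin n) ℝ} (hY : Y.IsHermitian) :
    ∃ U : Matrix (Fin n) (Fin n) ℝ, Uᵀ * U = 1 ∧ U * Uᵀ = 1 ∧
      Y = U * diagonal hY.eigenvalues * Uᵀ := by
  refine ⟨hY.eigenvectorUnitary, ?_, ?_, ?_⟩
  · have := Unitary.coe_star_mul_self hY.eigenvectorUnitary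
    simpa [star_eq_conjTranspose] using this
  · have := Unitary.coe_mul_star_self hY.eigenvectorUnitary
    simpa [star_eq_conjTranspose] using this
  · have := hY.spectral_theorem
    simpa [Unitary.conjStarAlgAut_apply, star_eq_conjTranspose, Function.comp_def] using this

lemma aux_major {n : ℕ} {v w : Fin n → ℝ} {D : Matrix (Fin n) (Fin n) ℝ}
    (h0 : ∀ i j, 0 ≤ D i j) (h1 : ∀ i, ∑ j, D i j = 1) (h2 : ∀ j, ∑ i, D i j = 1)
    (h : ∀ i, v i = ∑ j, D i j * w j) : VecMajorizedBy v w := by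
  constructor
  · intro s
    obtain ⟨c, hc0, hc1, hc⟩ := exists_eq_sum_perm_of_mem_doublyStochastic
      (mem_doublyStochastic_iff_sum.2 ⟨h0, h1, h2⟩)
    have hv : ∀ i, v i = ∑ σ : Equiv.Perm (Fin n), c σ * w (σ i) := by
      intro i
      rw [h, ← hc]
      simp only [Matrix.sum_apply, Matrix.smul_apply, Finset.sum_mul, smul_eq_mul]
      rw [Finset.sum_comm]
      refine Finset.sum_congr rfl fun σ _ => ?_
      simp [Equiv.Perm.permMatrix, PEquiv.toMatrix_apply]
    have hs : ∑ i ∈ s, v i = ∑ σ : Equiv.Perm (Fin n), c σ * ∑ i ∈ s, w (σ i) := by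
      simp only [hv, Finset.mul_sum]
      rw [Finset.sum_comm]
    have : ∃ σ : Equiv.Perm (Fin n), ∑ i ∈ s, v i ≤ ∑ i ∈ s, w (σ i) := by
      by_contra! hlt
      obtain ⟨σ₀, -, hσ₀⟩ : ∃ σ ∈ (Finset.univ : Finset (Equiv.Perm (Fin n))), 0 < c σ := by
        apply Finset.exists_lt_of_sum_lt
        simp [hc1]
      have : ∑ σ : Equiv.Perm (Fin n), c σ * ∑ i ∈ s, w (σ i)
          < ∑ σ : Equiv.Perm (Fin n), c σ * ∑ i ∈ s, v i := by
        refine Finset.sum_lt_sum (fun σ _ => mul_le_mul_of_nonneg_left (hlt σ).le (hc0 σ))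
          ⟨σ₀, Finset.mem_univ _, mul_lt_mul_of_pos_left (hlt σ₀) hσ₀⟩
      rw [← hs, ← Finset.sum_mul, hc1, one_mul] at this
      exact lt_irrefl _ this
    obtain ⟨σ, hσ⟩ := this
    refine ⟨s.map σ.toEmbedding, by simp, by simpa using hσ⟩
  · simp only [h]
    rw [Finset.sum_comm]
    simp [← Finset.sum_mul, h2]

lemma aux_corr {n : ℕ} {C Y : Matrix (Fin n) (Fin n) ℝ} (hC : C.PosSemidef)
    (hd : ∀ i, C i i = 1) (hY : Y.IsHermitian) (hZ : (C ⊙ Y).IsHermitian) :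
    VecMajorizedBy hZ.eigenvalues hY.eigenvalues := by
  obtain ⟨U, hU1, hU2, hU⟩ := aux_spectral hY
  obtain ⟨V, hV1, hV2, hV⟩ := aux_spectral hZ
  have hVd : Vᵀ * (C ⊙ Y) * V = diagonal hZ.eigenvalues := by
    conv_lhs => rw [hV]
    calc _ = (Vᵀ * V) * diagonal hZ.eigenvalues * (Vᵀ * V) := by simp only [Matrix.mul_assoc]
      _ = _ := by simp [hV1]
  have hYe : ∀ a b, Y a b = ∑ j, U a j * hY.eigenvalues j * U b j := by
    intro a b
    conv_lhs => rw [hU]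
    rw [Matrix.mul_apply]
    simp [Matrix.mul_diagonal]
  have one1 : ∀ (W : Matrix (Fin n) (Fin n) ℝ), W * Wᵀ = 1 → ∀ a b,
      ∑ j, W a j * W b j = if a = b then 1 else 0 := by
    intro W hW a b
    rw [← Matrix.one_apply, ← hW]
    simp [Matrix.mul_apply]
  have one2 : ∀ (W : Matrix (Fin n) (Fin n) ℝ), Wᵀ * W = 1 → ∀ j,
      ∑ a, W a j * W a j = 1 := by
    intro W hW j
    have := congrFun (congrFun hW j) j
    simpa [Matrix.mul_apply] using this
  have key : ∀ (P Q : Matrix (Fin n) (Fin n) ℝ), Qᵀ * Q = 1 → P * Pᵀ = 1 → ∀ i,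
      ∑ j, ∑ a, ∑ b, Q a i * P a j * C a b * (Q b i * P b j) = 1 := by
    intro P Q hQ hP i
    rw [Finset.sum_comm, ← one2 Q hQ i]
    refine Finset.sum_congr rfl fun a _ => ?_
    rw [Finset.sum_comm]
    have : ∀ b, ∑ j, Q a i * P a j * C a b * (Q b i * P b j)
        = Q a i * C a b * Q b i * (if a = b then 1 else 0) := by
      intro b
      rw [← one1 P hP a b, Finset.mul_sum]
      exact Finset.sum_congr rfl fun j _ => by ring
    simp [this, hd]
  refine aux_major (D := Matrix.of fun i j =>
    ∑ a, ∑ b, V a i * U a j * C a b * (V b i * U b j)) ?_ ?_ ?_ ?_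
  · intro i j
    have := hC.dotProduct_mulVec_nonneg (fun a => V a i * U a j)
    simpa [dotProduct, mulVec, Finset.mul_sum, mul_assoc] using this
  · intro i
    exact key U V hV1 hU2 i
  · intro j
    rw [← key V U hU1 hV2 j]
    simp only [Matrix.of_apply]
    refine Finset.sum_congr rfl fun i _ => Finset.sum_congr rfl fun a _ =>
      Finset.sum_congr rfl fun b _ => by ring
  · intro i
    have h := congrFun (congrFun hVd i) i
    rw [diagonal_apply_eq] at h
    rw [← h]
    simp only [Matrix.mul_apply, Matrix.transpose_apply, Matrix.hadamard_apply, Matrix.of_apply,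
      Finset.sum_mul, hYe, Finset.mul_sum]
    rw [Finset.sum_comm]
    conv_rhs => rw [Finset.sum_comm]
    refine Finset.sum_congr rfl fun a _ => ?_
    conv_rhs => rw [Finset.sum_comm]
    refine Finset.sum_congr rfl fun b _ => ?_
    refine Finset.sum_congr rfl fun j _ => ?_
    ring

lemma aux_pow {n : ℕ} {C : Matrix (Fin n) (Fin n) ℝ} (hC : C.PosSemidef) (k : ℕ) :
    (Matrix.of fun i j => C i j ^ (k + 1)).PosSemidef := by
  induction k with
  | zero =>
    have : (Matrix.of fun i j => C i j ^ (0 + 1)) = C := by ext i j; simp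
    rw [this]; exact hC
  | succ k ih =>
    have h := ih.hadamard hC
    have : (Matrix.of fun i j => C i j ^ (k + 1 + 1))
        = (Matrix.of fun i j => C i j ^ (k + 1)) ⊙ C := by
      ext i j; simp [pow_succ]
    rw [this]; exact h

/-- If `A`, `B` are real symmetric with all `a ij ≠ 0`, `b ij ≠ 0` and the matrix of ratios
`[a ij / b ij]` is a correlation matrix, then for every positive integer `k` and every
symmetric `X`, `B⁽⁻ᵏ⁾ ⊙ X` is majorized by `A⁽⁻ᵏ⁾ ⊙ X` (entrywise (-k)-th powers). -/
theorem hadamardNegPow_majorized {n : ℕ} (A B : Matrix (Fin n) (Fin n) ℝ)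
    (hA : A.IsHermitian) (hB : B.IsHermitian)
    (hAne : ∀ i j, A i j ≠ 0) (hBne : ∀ i j, B i j ≠ 0)
    (hC : (Matrix.of fun i j => A i j / B i j).PosSemidef)
    (hCdiag : ∀ i, A i i / B i i = 1)
    (k : ℕ) (hk : 0 < k) (X : Matrix (Fin n) (Fin n) ℝ) (hX : X.IsHermitian) :
    MatMajorizedBy ((Matrix.of fun i j => B i j ^ (-(k : ℤ))) ⊙ X)
      ((Matrix.of fun i j => A i j ^ (-(k : ℤ))) ⊙ X) := by
  have hYh : ((Matrix.of fun i j => A i j ^ (-(k : ℤ))) ⊙ X).IsHermitian := by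
    ext i j
    have h1 := hA.apply i j
    have h2 := hX.apply i j
    simp only [star_trivial] at h1 h2
    simp [h1, h2]
  have hZh : ((Matrix.of fun i j => B i j ^ (-(k : ℤ))) ⊙ X).IsHermitian := by
    ext i j
    have h1 := hB.apply i j
    have h2 := hX.apply i j
    simp only [star_trivial] at h1 h2
    simp [h1, h2]
  refine ⟨hZh, hYh, ?_⟩
  obtain ⟨m, rfl⟩ : ∃ m, k = m + 1 := ⟨k - 1, by omega⟩
  have hP := aux_pow hC m
  have heq : (Matrix.of fun i j => B i j ^ (-((m + 1 : ℕ) : ℤ))) ⊙ X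
      = (Matrix.of fun i j => (Matrix.of fun i j => A i j / B i j) i j ^ (m + 1)) ⊙
        ((Matrix.of fun i j => A i j ^ (-((m + 1 : ℕ) : ℤ))) ⊙ X) := by
    ext i j
    have h1 := pow_ne_zero (m + 1) (hAne i j)
    have h2 := pow_ne_zero (m + 1) (hBne i j)
    simp only [Matrix.hadamard_apply, Matrix.of_apply, _root_.zpow_neg, zpow_natCast, div_pow]
    field_simp
  have hfin : ∀ (Z : Matrix (Fin n) (Fin n) ℝ) (hZ : Z.IsHermitian),
      Z = (Matrix.of fun i j => (Matrix.of fun i j => A i j / B i j) i j ^ (m + 1)) ⊙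
        ((Matrix.of fun i j => A i j ^ (-((m + 1 : ℕ) : ℤ))) ⊙ X) →
      VecMajorizedBy hZ.eigenvalues hYh.eigenvalues := by
    intro Z hZ h
    subst h
    exact aux_corr hP (fun i => by simp [hCdiag]) hYh hZ
  exact hfin _ hZh heq
end

section
/- Let A be an n×n real symmetric positive definite matrix, and for s ≥ 0 let A^s denote the matrix power defined via the spectral decomposition of A (raising each eigenvalue to the power s). Then for every t ∈ [0,1] and every n×n real symmetric matrix X, the matrix A^{1/2} X A^{1/2} is majorized by (A^t X A^{1−t} + A^{1−t} X A^t)/2, which in turn is majorized by (AX + XA)/2. -/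
open Matrix

/-- The real power `A ^ s` of a symmetric matrix `A`, defined via the spectral
decomposition of `A`: each eigenvalue is raised to the power `s`, keeping the
eigenvectors. -/
noncomputable def matRPow {n : ℕ} {A : Matrix (Fin n) (Fin n) ℝ}
    (hA : A.IsHermitian) (s : ℝ) : Matrix (Fin n) (Fin n) ℝ :=
  (hA.eigenvectorUnitary : Matrix (Fin n) (Fin n) ℝ) *
    Matrix.diagonal (fun i => hA.eigenvalues i ^ s) *
      star (hA.eigenvectorUnitary : Matrix (Fin n) (Fin n) ℝ)

namespace MajAux

/-- Real positive semidefiniteness through the double-sum quadratic form. -/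
lemma psd_of_quad {n : ℕ} {M : Matrix (Fin n) (Fin n) ℝ} (hs : ∀ i j, M i j = M j i)
    (h : ∀ x : Fin n → ℝ, 0 ≤ ∑ i, ∑ j, x i * M i j * x j) : M.PosSemidef := by
  refine Matrix.PosSemidef.of_dotProduct_mulVec_nonneg ?_ ?_
  · ext i j
    simp [Matrix.conjTranspose_apply, hs i j]
  · intro x
    have := h x
    simpa [dotProduct, Matrix.mulVec, Finset.mul_sum, mul_assoc] using this

lemma quad_of_psd {n : ℕ} {M : Matrix (Fin n) (Fin n) ℝ} (h : M.PosSemidef)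
    (x : Fin n → ℝ) : 0 ≤ ∑ i, ∑ j, x i * M i j * x j := by
  have := h.dotProduct_mulVec_nonneg x
  simpa [dotProduct, Matrix.mulVec, Finset.mul_sum, mul_assoc] using this

lemma had_psd {n : ℕ} {A B : Matrix (Fin n) (Fin n) ℝ} (hA : A.PosSemidef)
    (hB : B.PosSemidef) : (A ⊙ B).PosSemidef := hA.hadamard hB

/-- The Cauchy matrix is positive semidefinite. -/
lemma cauchy_psd {n : ℕ} (b : Fin n → ℝ) (hb : ∀ i, 0 < b i) :
    (Matrix.of fun i j => 1 / (b i + b j) : Matrix (Fin n) (Fin n) ℝ).PosSemidef := by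
  refine psd_of_quad (fun i j => by simp [add_comm]) fun x => ?_
  have hneg : ∀ i j, -(b i + b j) < 0 := fun i j => by linarith [hb i, hb j]
  have key : ∑ i, ∑ j, x i * (Matrix.of fun i j => 1 / (b i + b j) : Matrix _ _ ℝ) i j * x j
      = ∫ s in Set.Ioi (0 : ℝ), (∑ i, x i * Real.exp (-(b i) * s)) ^ 2 := by
    have e : ∀ s : ℝ, (∑ i, x i * Real.exp (-(b i) * s)) ^ 2
        = ∑ i, ∑ j, (x i * x j) * Real.exp (-(b i + b j) * s) := by
      intro s
      rw [sq, Finset.sum_mul_sum]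
      refine Finset.sum_congr rfl fun i _ => Finset.sum_congr rfl fun j _ => ?_
      rw [show -(b i + b j) * s = -(b i) * s + -(b j) * s by ring, Real.exp_add]
      ring
    have hint : ∀ i j, MeasureTheory.IntegrableOn
        (fun s => (x i * x j) * Real.exp (-(b i + b j) * s)) (Set.Ioi 0) := fun i j =>
      (integrableOn_exp_mul_Ioi (hneg i j) 0).const_mul _
    simp_rw [e]
    rw [MeasureTheory.integral_finsetSum _ fun i _ =>
      MeasureTheory.integrable_finsetSum _ fun j _ => hint i j]
    refine Finset.sum_congr rfl fun i _ => ?_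
    rw [MeasureTheory.integral_finsetSum _ fun j _ => hint i j]
    refine Finset.sum_congr rfl fun j _ => ?_
    rw [MeasureTheory.integral_const_mul, integral_exp_mul_Ioi (hneg i j)]
    simp only [mul_zero, Real.exp_zero, Matrix.of_apply, neg_div_neg_eq]
    ring
  rw [key]
  exact MeasureTheory.integral_nonneg fun s => sq_nonneg _

/-- `1 / cosh (l i - l j)` is positive semidefinite. -/
lemma sech_psd {n : ℕ} (l : Fin n → ℝ) :
    (Matrix.of fun i j => 1 / Real.cosh (l i - l j) : Matrix (Fin n) (Fin n) ℝ).PosSemidef := by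
  have h1 := cauchy_psd (fun i => Real.exp (2 * l i)) fun i => Real.exp_pos _
  have h2 := Matrix.posSemidef_vecMulVec_self_star (fun i => Real.sqrt 2 * Real.exp (l i))
  have h3 := had_psd h2 h1
  convert h3 using 1
  ext i j
  have e1 : Real.exp (2 * l i) = Real.exp (l i) ^ 2 := by
    rw [← Real.exp_nat_mul]; norm_num
  have e2 : Real.exp (2 * l j) = Real.exp (l j) ^ 2 := by
    rw [← Real.exp_nat_mul]; norm_num
  have p1 := Real.exp_pos (l i)
  have p2 := Real.exp_pos (l j)
  have hs : Real.sqrt 2 * Real.sqrt 2 = 2 := Real.mul_self_sqrt (by norm_num)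
  simp only [Matrix.of_apply, Matrix.hadamard_apply, Matrix.vecMulVec_apply, Pi.star_apply,
    star_trivial, e1, e2]
  rw [show Real.sqrt 2 * Real.exp (l i) * (Real.sqrt 2 * Real.exp (l j))
    = (Real.sqrt 2 * Real.sqrt 2) * (Real.exp (l i) * Real.exp (l j)) by ring, hs,
    Real.cosh_eq, neg_sub, Real.exp_sub, Real.exp_sub]
  field_simp

/-- The kernel `cosh (α d) / cosh d`. -/
noncomputable def ker {n : ℕ} (l : Fin n → ℝ) (α : ℝ) : Matrix (Fin n) (Fin n) ℝ :=
  Matrix.of fun i j => Real.cosh (α * (l i - l j)) / Real.cosh (l i - l j)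

lemma ker_symm {n : ℕ} (l : Fin n → ℝ) (α : ℝ) (i j : Fin n) : ker l α i j = ker l α j i := by
  simp only [ker, Matrix.of_apply]
  rw [← Real.cosh_neg, ← Real.cosh_neg (l i - l j)]
  congr 2 <;> ring

lemma ker_neg {n : ℕ} (l : Fin n → ℝ) (α : ℝ) : ker l (-α) = ker l α := by
  ext i j
  simp [ker, neg_mul, Real.cosh_neg]

lemma ker_bound {n : ℕ} (l : Fin n → ℝ) (α : ℝ) (h : |α| ≤ 1) (i j : Fin n) :
    |ker l α i j| ≤ 1 := by
  simp only [ker, Matrix.of_apply]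
  rw [abs_div, abs_of_pos (Real.cosh_pos _), abs_of_pos (Real.cosh_pos _),
    div_le_one (Real.cosh_pos _), Real.cosh_le_cosh, abs_mul]
  nlinarith [abs_nonneg (l i - l j)]

lemma ker_init {n : ℕ} (l : Fin n → ℝ) (α : ℝ) (h : |α| ≤ 1) :
    (ker l α + (n : ℝ) • (1 : Matrix (Fin n) (Fin n) ℝ)).PosSemidef := by
  refine psd_of_quad (fun i j => ?_) fun x => ?_
  · simp only [Matrix.add_apply, Matrix.smul_apply, ker_symm l α i j, Matrix.one_apply, eq_comm]
  · have e : ∑ i, ∑ j, x i * (ker l α + (n : ℝ) • (1 : Matrix (Fin n) (Fin n) ℝ)) i j * x j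
        = ∑ i, ∑ j, (x i * ker l α i j * x j + (x i ^ 2 + x j ^ 2) / 2) := by
      have a : ∑ i : Fin n, ∑ j : Fin n, (x i ^ 2 + x j ^ 2) / 2 = n * ∑ i, x i ^ 2 := by
        simp only [add_div, Finset.sum_add_distrib, Finset.sum_const, Finset.card_univ,
          Fintype.card_fin, nsmul_eq_mul, ← Finset.mul_sum, ← Finset.sum_div]
        ring
      have b : ∑ i, ∑ j, x i * ((n : ℝ) • (1 : Matrix (Fin n) (Fin n) ℝ)) i j * x j
          = n * ∑ i, x i ^ 2 := by
        simp only [Matrix.smul_apply, Matrix.one_apply, smul_eq_mul, mul_ite, ite_mul, mul_one,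
          mul_zero, zero_mul, Finset.sum_ite_eq, Finset.mem_univ, if_true, Finset.mul_sum]
        exact Finset.sum_congr rfl fun i _ => by ring
      simp only [Matrix.add_apply, mul_add, add_mul, Finset.sum_add_distrib] at *
      rw [a, b]
    rw [e]
    refine Finset.sum_nonneg fun i _ => Finset.sum_nonneg fun j _ => ?_
    obtain ⟨h1, h2⟩ := abs_le.1 (ker_bound l α h i j)
    nlinarith [mul_nonneg (by linarith : 0 ≤ 1 + ker l α i j) (sq_nonneg (x i + x j)),
      mul_nonneg (by linarith : 0 ≤ 1 - ker l α i j) (sq_nonneg (x i - x j))]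

lemma ker_step {n : ℕ} (l : Fin n → ℝ) (α m : ℝ)
    (h : (ker l (2 * α - 1) + m • (1 : Matrix (Fin n) (Fin n) ℝ)).PosSemidef) :
    (ker l α + (m / 2) • (1 : Matrix (Fin n) (Fin n) ℝ)).PosSemidef := by
  have hS := sech_psd fun i => (1 - α) * l i
  have hJ := Matrix.posSemidef_vecMulVec_self_star (fun _ : Fin n => (1 : ℝ))
  have h1 := had_psd hS ((hJ.add h).smul (by norm_num : (0 : ℝ) ≤ 1 / 2))
  convert h1 using 1
  ext i j
  simp only [Matrix.of_apply, Matrix.hadamard_apply, Matrix.vecMulVec_apply, Pi.star_apply,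
    star_trivial, Matrix.add_apply, Matrix.smul_apply, smul_eq_mul, ker]
  by_cases hij : i = j
  · subst hij
    simp
    ring
  · simp only [Matrix.one_apply_ne hij]
    set d := l i - l j
    rw [show (1 - α) * l i - (1 - α) * l j = (1 - α) * d by simp only [d]; ring]
    have c1 := (Real.cosh_pos ((1 - α) * d)).ne'
    have c2 := (Real.cosh_pos d).ne'
    have k1 := Real.cosh_add (α * d) ((1 - α) * d)
    have k2 := Real.cosh_sub (α * d) ((1 - α) * d)
    rw [show α * d + (1 - α) * d = d by ring] at k1
    rw [show α * d - (1 - α) * d = (2 * α - 1) * d by ring] at k2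
    generalize Real.cosh ((1 - α) * d) = y at *
    generalize Real.cosh ((2 * α - 1) * d) = z at *
    generalize Real.cosh (α * d) = x at *
    generalize Real.cosh d = w at *
    simp only [mul_zero, add_zero]
    field_simp
    linarith

lemma ker_iter {n : ℕ} (l : Fin n → ℝ) (N : ℕ) : ∀ α : ℝ, |α| ≤ 1 →
    (ker l α + ((n : ℝ) / 2 ^ N) • (1 : Matrix (Fin n) (Fin n) ℝ)).PosSemidef := by
  induction N with
  | zero => intro α h; simpa using ker_init l α h
  | succ N ih =>
    have pos : ∀ α : ℝ, 0 ≤ α → α ≤ 1 →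
        (ker l α + ((n : ℝ) / 2 ^ (N + 1)) • (1 : Matrix (Fin n) (Fin n) ℝ)).PosSemidef := by
      intro α h0 h1
      rw [pow_succ, ← div_div]
      exact ker_step l α _ (ih _ (abs_le.2 ⟨by linarith, by linarith⟩))
    intro α h
    obtain ⟨h1, h2⟩ := abs_le.1 h
    rcases le_total 0 α with h0 | h0
    · exact pos α h0 h2
    · rw [← ker_neg]
      exact pos (-α) (by linarith) (by linarith)

lemma ker_psd {n : ℕ} (l : Fin n → ℝ) (α : ℝ) (h : |α| ≤ 1) : (ker l α).PosSemidef := by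
  refine psd_of_quad (ker_symm l α) fun x => ?_
  have hN : ∀ N : ℕ, 0 ≤ ∑ i, ∑ j, x i * ker l α i j * x j
      + ((n : ℝ) * ∑ i, x i ^ 2) * (1 / 2) ^ N := by
    intro N
    have := quad_of_psd (ker_iter l N α h) x
    have b : ∑ i, ∑ j, x i * (((n : ℝ) / 2 ^ N) • (1 : Matrix (Fin n) (Fin n) ℝ)) i j * x j
          = ((n : ℝ) * ∑ i, x i ^ 2) * (1 / 2) ^ N := by
      simp only [Matrix.smul_apply, Matrix.one_apply, smul_eq_mul, mul_ite, ite_mul, mul_one,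
          mul_zero, zero_mul, Finset.sum_ite_eq, Finset.mem_univ, if_true, Finset.mul_sum,
          Finset.sum_mul]
      exact Finset.sum_congr rfl fun i _ => by rw [div_pow, one_pow]; ring
    simp only [Matrix.add_apply, mul_add, add_mul, Finset.sum_add_distrib] at this
    rwa [b] at this
  have ht : Filter.Tendsto (fun N : ℕ => ∑ i, ∑ j, x i * ker l α i j * x j
      + ((n : ℝ) * ∑ i, x i ^ 2) * (1 / 2) ^ N) Filter.atTop
      (nhds (∑ i, ∑ j, x i * ker l α i j * x j + ((n : ℝ) * ∑ i, x i ^ 2) * 0)) :=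
    ((tendsto_pow_atTop_nhds_zero_of_lt_one (by norm_num) (by norm_num)).const_mul _).const_add _
  rw [mul_zero, add_zero] at ht
  exact ge_of_tendsto' ht hN

/-- A fractional selection of total weight `k` is dominated by some `k`-subset. -/
lemma exists_subset {n : ℕ} (w p : Fin n → ℝ) (k : ℕ) (hk : k ≤ n)
    (h0 : ∀ i, 0 ≤ p i) (h1 : ∀ i, p i ≤ 1) (hp : ∑ i, p i = k) :
    ∃ T : Finset (Fin n), T.card = k ∧ ∑ i, p i * w i ≤ ∑ i ∈ T, w i := by
  obtain ⟨T, hT, hmax⟩ := Finset.exists_max_image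
    (Finset.powersetCard k (Finset.univ : Finset (Fin n))) (fun T => ∑ i ∈ T, w i)
    (Finset.powersetCard_nonempty.2 (by simpa using hk))
  have hc : T.card = k := (Finset.mem_powersetCard.1 hT).2
  refine ⟨T, hc, ?_⟩
  have swap : ∀ i ∈ T, ∀ j, j ∉ T → w j ≤ w i := by
    intro i hi j hj
    have hj' : j ∉ T.erase i := fun h => hj (Finset.mem_of_mem_erase h)
    have := hmax (insert j (T.erase i)) (Finset.mem_powersetCard.2 ⟨Finset.subset_univ _, by
      rw [Finset.card_insert_of_notMem hj', Finset.card_erase_add_one hi, hc]⟩)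
    simp only [Finset.sum_insert hj'] at this
    have e := Finset.add_sum_erase T w hi
    linarith
  rcases T.eq_empty_or_nonempty with he | hne
  · subst he
    have hk0 : k = 0 := by simpa using hc.symm
    subst hk0
    have := (Finset.sum_eq_zero_iff_of_nonneg fun i _ => h0 i).1 (by simpa using hp)
    simp only [Finset.sum_empty]
    refine (Finset.sum_eq_zero fun i hi => ?_).le
    rw [this i hi, zero_mul]
  · obtain ⟨m, hm, hmin⟩ := Finset.exists_min_image T w hne
    have e1 : ∑ i ∈ T, w i = ∑ i, (if i ∈ T then 1 else 0) * w i := by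
      simp
    have e2 : ∑ i : Fin n, (if i ∈ T then (1 : ℝ) else 0) = k := by
      simp [hc]
    have : ∑ i, (p i - if i ∈ T then (1 : ℝ) else 0) * (w i - w m) ≤ 0 := by
      refine Finset.sum_nonpos fun i _ => ?_
      by_cases hi : i ∈ T
      · simp only [hi, if_true]
        nlinarith [h1 i, hmin i hi]
      · simp only [hi, if_false]
        nlinarith [h0 i, swap m hm i hi]
    simp only [sub_mul, mul_sub, Finset.sum_sub_distrib, ← Finset.sum_mul, hp, e2] at this
    rw [e1]
    linarith

lemma spectral {n : ℕ} {Y : Matrix (Fin n) (Fin n) ℝ} (hY : Y.IsHermitian) :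
    Y = (hY.eigenvectorUnitary : Matrix (Fin n) (Fin n) ℝ) * Matrix.diagonal hY.eigenvalues *
      (hY.eigenvectorUnitary : Matrix (Fin n) (Fin n) ℝ)ᴴ := by
  have := hY.spectral_theorem
  rw [Unitary.conjStarAlgAut_apply] at this
  exact this

lemma unitary_left {n : ℕ} {Y : Matrix (Fin n) (Fin n) ℝ} (hY : Y.IsHermitian) :
    (hY.eigenvectorUnitary : Matrix (Fin n) (Fin n) ℝ)ᴴ * hY.eigenvectorUnitary = 1 :=
  Unitary.coe_star_mul_self hY.eigenvectorUnitary

lemma unitary_right {n : ℕ} {Y : Matrix (Fin n) (Fin n) ℝ} (hY : Y.IsHermitian) :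
    (hY.eigenvectorUnitary : Matrix (Fin n) (Fin n) ℝ) *
      (hY.eigenvectorUnitary : Matrix (Fin n) (Fin n) ℝ)ᴴ = 1 :=
  Unitary.coe_mul_star_self hY.eigenvectorUnitary

lemma trace_diag_mul {n : ℕ} (Q : Matrix (Fin n) (Fin n) ℝ) (d : Fin n → ℝ) :
    (Q * Matrix.diagonal d).trace = ∑ i, Q i i * d i := by
  simp [Matrix.trace, Matrix.mul_diagonal]

/-- Upper bound half of the Ky Fan principle. -/
lemma kyfan_upper {n : ℕ} {Y : Matrix (Fin n) (Fin n) ℝ} (hY : Y.IsHermitian)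
    (P : Matrix (Fin n) (Fin n) ℝ) (hP : P.PosSemidef) (hP' : (1 - P).PosSemidef) (k : ℕ)
    (hk : k ≤ n) (htr : P.trace = k) :
    ∃ T : Finset (Fin n), T.card = k ∧ (P * Y).trace ≤ ∑ i ∈ T, hY.eigenvalues i := by
  set V : Matrix (Fin n) (Fin n) ℝ := (hY.eigenvectorUnitary : Matrix (Fin n) (Fin n) ℝ) with hV
  have hVl : Vᴴ * V = 1 := unitary_left hY
  have hVr : V * Vᴴ = 1 := unitary_right hY
  have q0 := hP.conjTranspose_mul_mul_same V
  have q1 := hP'.conjTranspose_mul_mul_same V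
  have e1 : Vᴴ * (1 - P) * V = 1 - Vᴴ * P * V := by
    rw [mul_sub, sub_mul, mul_one, hVl]
  rw [e1] at q1
  have et : (Vᴴ * P * V).trace = k := by
    rw [Matrix.trace_mul_comm, ← mul_assoc, hVr, one_mul, htr]
  obtain ⟨T, hT, h⟩ := exists_subset hY.eigenvalues (fun i => (Vᴴ * P * V) i i) k hk
    (fun i => q0.diag_nonneg) (fun i => by
      have := q1.diag_nonneg (i := i)
      simpa using this) et
  refine ⟨T, hT, le_trans (le_of_eq ?_) h⟩
  rw [← trace_diag_mul]
  conv_lhs => rw [spectral hY]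
  rw [← hV, ← mul_assoc, Matrix.trace_mul_comm]
  simp only [mul_assoc]

/-- Attainment half of the Ky Fan principle. -/
lemma kyfan_lower {n : ℕ} {Y : Matrix (Fin n) (Fin n) ℝ} (hY : Y.IsHermitian)
    (s : Finset (Fin n)) : ∃ P : Matrix (Fin n) (Fin n) ℝ, P.PosSemidef ∧ (1 - P).PosSemidef ∧
      P.trace = s.card ∧ (P * Y).trace = ∑ i ∈ s, hY.eigenvalues i := by
  set V : Matrix (Fin n) (Fin n) ℝ := (hY.eigenvectorUnitary : Matrix (Fin n) (Fin n) ℝ) with hV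
  have hVl : Vᴴ * V = 1 := unitary_left hY
  have hVr : V * Vᴴ = 1 := unitary_right hY
  set d : Fin n → ℝ := fun i => if i ∈ s then 1 else 0 with hd
  have hd0 : 0 ≤ d := fun i => by simp only [hd, Pi.zero_apply]; split_ifs <;> norm_num
  have hd1 : 0 ≤ 1 - d := fun i => by
    simp only [hd, Pi.zero_apply, Pi.sub_apply, Pi.one_apply]; split_ifs <;> norm_num
  refine ⟨V * Matrix.diagonal d * Vᴴ, (Matrix.PosSemidef.diagonal hd0).mul_mul_conjTranspose_same V,
    ?_, ?_, ?_⟩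
  · have := (Matrix.PosSemidef.diagonal hd1).mul_mul_conjTranspose_same V
    convert this using 1
    have : Matrix.diagonal (1 - d) = 1 - Matrix.diagonal d := by
      rw [← Matrix.diagonal_one, Matrix.diagonal_sub]; rfl
    rw [this, mul_sub, sub_mul, mul_one, hVr]
  · rw [Matrix.trace_mul_comm, ← mul_assoc, hVl, one_mul, Matrix.trace_diagonal]
    simp [hd]
  · have : V * Matrix.diagonal d * Vᴴ * Y
        = V * (Matrix.diagonal d * Matrix.diagonal hY.eigenvalues) * Vᴴ := by
      conv_lhs => rw [spectral hY]
      rw [← hV]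
      calc _ = V * Matrix.diagonal d * (Vᴴ * V) * Matrix.diagonal hY.eigenvalues * Vᴴ := by
            simp only [mul_assoc]
        _ = _ := by rw [hVl]; simp only [mul_assoc, one_mul]
    rw [this, Matrix.trace_mul_comm, ← mul_assoc, hVl, one_mul, trace_diag_mul]
    simp [hd]

lemma trace_hadamard_swap {n : ℕ} (C Q W : Matrix (Fin n) (Fin n) ℝ)
    (hC : ∀ i j, C i j = C j i) : (Q * (C ⊙ W)).trace = ((C ⊙ Q) * W).trace := by
  simp only [Matrix.trace, Matrix.diag, Matrix.mul_apply, Matrix.hadamard_apply]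
  refine Finset.sum_congr rfl fun i _ => Finset.sum_congr rfl fun j _ => ?_
  rw [hC j i]
  ring

/-- Schur multiplication by a correlation matrix produces a majorized matrix. -/
lemma schur_majorized {n : ℕ} (U C W : Matrix (Fin n) (Fin n) ℝ)
    (hUl : Uᴴ * U = 1) (hUr : U * Uᴴ = 1) (hC : C.PosSemidef) (hC1 : ∀ i, C i i = 1)
    (hW : W.IsHermitian) : MatMajorizedBy (U * (C ⊙ W) * Uᴴ) (U * W * Uᴴ) := by
  have hCs : ∀ i j, C i j = C j i := fun i j => by
    have := hC.isHermitian.apply i j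
    simpa using this.symm
  have hCW : (C ⊙ W).IsHermitian := by
    ext i j
    have := hW.apply i j
    simp only [star_trivial] at this
    simp [Matrix.conjTranspose_apply, Matrix.hadamard_apply, hCs j i, this]
  have h1 : (U * (C ⊙ W) * Uᴴ).IsHermitian := Matrix.isHermitian_mul_mul_conjTranspose U hCW
  have h2 : (U * W * Uᴴ).IsHermitian := Matrix.isHermitian_mul_mul_conjTranspose U hW
  have diagEq : ∀ Q : Matrix (Fin n) (Fin n) ℝ, (C ⊙ Q).trace = Q.trace := fun Q => by
    simp [Matrix.trace, hC1]
  refine ⟨h1, h2, fun s => ?_, ?_⟩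
  · obtain ⟨P, hP, hP', htr, hsum⟩ := kyfan_lower h1 s
    set Q := Uᴴ * P * U with hQ
    have hQ0 : Q.PosSemidef := hP.conjTranspose_mul_mul_same U
    have hQ1 : (1 - Q).PosSemidef := by
      have := hP'.conjTranspose_mul_mul_same U
      rwa [mul_sub, sub_mul, mul_one, hUl] at this
    have hR0 := (had_psd hC hQ0).mul_mul_conjTranspose_same U
    have hR1 : (1 - U * (C ⊙ Q) * Uᴴ).PosSemidef := by
      have := (had_psd hC hQ1).mul_mul_conjTranspose_same U
      have e : C ⊙ (1 - Q) = 1 - C ⊙ Q := by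
        ext i j
        by_cases hij : i = j
        · subst hij; simp [hC1]
          try ring
        · simp [Matrix.one_apply_ne hij]
      rwa [e, mul_sub, sub_mul, mul_one, hUr] at this
    have hRt : (U * (C ⊙ Q) * Uᴴ).trace = (s.card : ℝ) := by
      rw [Matrix.trace_mul_comm, ← mul_assoc, hUl, one_mul, diagEq, hQ, Matrix.trace_mul_comm,
        ← mul_assoc, hUr, one_mul, htr]
    obtain ⟨T, hT, h⟩ := kyfan_upper h2 _ hR0 hR1 s.card (by simpa using Finset.card_le_univ s) hRt
    refine ⟨T, hT, le_trans (le_of_eq ?_) h⟩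
    rw [← hsum]
    calc (P * (U * (C ⊙ W) * Uᴴ)).trace = (Q * (C ⊙ W)).trace := by
          rw [← mul_assoc, Matrix.trace_mul_comm, hQ]; simp only [mul_assoc]
      _ = ((C ⊙ Q) * W).trace := trace_hadamard_swap C Q W hCs
      _ = (U * ((C ⊙ Q) * W) * Uᴴ).trace := by
          rw [Matrix.trace_mul_comm (U * _), ← mul_assoc Uᴴ, hUl, one_mul]
      _ = _ := by
          congr 1
          calc U * ((C ⊙ Q) * W) * Uᴴ = U * (C ⊙ Q) * 1 * W * Uᴴ := by
                simp only [mul_assoc, one_mul]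
            _ = _ := by rw [← hUl]; simp only [mul_assoc]
  · have t1 := h1.trace_eq_sum_eigenvalues
    have t2 := h2.trace_eq_sum_eigenvalues
    simp only [RCLike.ofReal_real_eq_id, id_eq] at t1 t2
    rw [← t1, ← t2, Matrix.trace_mul_comm, ← mul_assoc, hUl, one_mul, diagEq,
      Matrix.trace_mul_comm (U * W), ← mul_assoc, hUl, one_mul]

/-- The multiplier of the power mean in the eigenbasis of `A`. -/
noncomputable def mult {n : ℕ} (a : Fin n → ℝ) (p q : ℝ) : Matrix (Fin n) (Fin n) ℝ :=
  Matrix.of fun i j => (a i ^ p * a j ^ q + a i ^ q * a j ^ p) / 2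

lemma mult_eq {n : ℕ} (a : Fin n → ℝ) (ha : ∀ i, 0 < a i) (t : ℝ) (i j : Fin n) :
    mult a t (1 - t) i j = Real.exp ((Real.log (a i) + Real.log (a j)) / 2) *
      Real.cosh ((t - 1 / 2) * (Real.log (a i) - Real.log (a j))) := by
  simp only [mult, Matrix.of_apply, Real.rpow_def_of_pos (ha _), Real.cosh_eq]
  rw [← Real.exp_add, ← Real.exp_add, mul_div_assoc', mul_add, ← Real.exp_add, ← Real.exp_add]
  congr 3 <;> ring

lemma mean_eq {n : ℕ} {A : Matrix (Fin n) (Fin n) ℝ} (hA : A.IsHermitian)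
    (X : Matrix (Fin n) (Fin n) ℝ) (p q : ℝ) :
    (2 : ℝ)⁻¹ • (matRPow hA p * X * matRPow hA q + matRPow hA q * X * matRPow hA p) =
      (hA.eigenvectorUnitary : Matrix (Fin n) (Fin n) ℝ) * (mult hA.eigenvalues p q ⊙
        ((hA.eigenvectorUnitary : Matrix (Fin n) (Fin n) ℝ)ᴴ * X * hA.eigenvectorUnitary)) *
        (hA.eigenvectorUnitary : Matrix (Fin n) (Fin n) ℝ)ᴴ := by
  simp only [matRPow, Matrix.star_eq_conjTranspose]
  set U : Matrix (Fin n) (Fin n) ℝ := (hA.eigenvectorUnitary : Matrix (Fin n) (Fin n) ℝ)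
  have e : mult hA.eigenvalues p q ⊙ (Uᴴ * X * U) = (2 : ℝ)⁻¹ •
      (Matrix.diagonal (fun i => hA.eigenvalues i ^ p) * (Uᴴ * X * U) *
        Matrix.diagonal (fun i => hA.eigenvalues i ^ q) +
      Matrix.diagonal (fun i => hA.eigenvalues i ^ q) * (Uᴴ * X * U) *
        Matrix.diagonal (fun i => hA.eigenvalues i ^ p)) := by
    ext i j
    simp only [mult, Matrix.hadamard_apply, Matrix.of_apply, Matrix.smul_apply, Matrix.add_apply,
      Matrix.mul_diagonal, Matrix.diagonal_mul, smul_eq_mul]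
    ring
  rw [e, mul_smul_comm, smul_mul_assoc, mul_add, add_mul]
  simp only [mul_assoc]

lemma matRPow_zero {n : ℕ} {A : Matrix (Fin n) (Fin n) ℝ} (hA : A.IsHermitian) :
    matRPow hA 0 = 1 := by
  simp only [matRPow, Real.rpow_zero, Matrix.diagonal_one, mul_one]
  exact unitary_right hA

lemma matRPow_one {n : ℕ} {A : Matrix (Fin n) (Fin n) ℝ} (hA : A.IsHermitian) :
    matRPow hA 1 = A := by
  simp only [matRPow, Real.rpow_one]
  exact (spectral hA).symm

/-- Comparison of two means whenever the quotient of multipliers is a `ker`. -/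
lemma mean_majorized {n : ℕ} {A : Matrix (Fin n) (Fin n) ℝ} (hA : A.PosDef)
    (X : Matrix (Fin n) (Fin n) ℝ) (hX : X.IsHermitian) (r t α : ℝ) (hα : |α| ≤ 1)
    (hr : r - 1 / 2 = α * (t - 1 / 2)) :
    MatMajorizedBy
      ((2 : ℝ)⁻¹ • (matRPow hA.isHermitian r * X * matRPow hA.isHermitian (1 - r) +
        matRPow hA.isHermitian (1 - r) * X * matRPow hA.isHermitian r))
      ((2 : ℝ)⁻¹ • (matRPow hA.isHermitian t * X * matRPow hA.isHermitian (1 - t) +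
        matRPow hA.isHermitian (1 - t) * X * matRPow hA.isHermitian t)) := by
  rw [mean_eq, mean_eq]
  set a := hA.isHermitian.eigenvalues with ha
  have hpos : ∀ i, 0 < a i := hA.eigenvalues_pos
  set U : Matrix (Fin n) (Fin n) ℝ := (hA.isHermitian.eigenvectorUnitary : Matrix (Fin n) (Fin n) ℝ)
  set l : Fin n → ℝ := fun i => (t - 1 / 2) * Real.log (a i) with hl
  have e : mult a r (1 - r) = ker l α ⊙ mult a t (1 - t) := by
    ext i j
    rw [Matrix.hadamard_apply, mult_eq a hpos, mult_eq a hpos, hr]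
    simp only [ker, Matrix.of_apply, hl, ← mul_sub]
    have := (Real.cosh_pos ((t - 1 / 2) * (Real.log (a i) - Real.log (a j)))).ne'
    field_simp
  rw [e, Matrix.hadamard_assoc]
  refine schur_majorized U (ker l α) _ (unitary_left _) (unitary_right _) (ker_psd l α hα)
    (fun i => by simp [ker]) ?_
  have hX' : (Uᴴ * X * U).IsHermitian := Matrix.isHermitian_conjTranspose_mul_mul U hX
  ext i j
  have h1 := hX'.apply i j
  simp only [star_trivial] at h1
  simp only [Matrix.conjTranspose_apply, Matrix.hadamard_apply, star_trivial, h1, mult,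
    Matrix.of_apply]
  ring

end MajAux

/-- For a real symmetric positive definite `A`, every `t ∈ [0,1]` and every symmetric `X`:
`A^{1/2} X A^{1/2}` is majorized by `(AᵗXA^{1-t} + A^{1-t}XAᵗ)/2`, which in turn is
majorized by `(AX + XA)/2`. -/
theorem sqrt_majorized_power_mean_majorized_lyapunov {n : ℕ}
    (A : Matrix (Fin n) (Fin n) ℝ) (hA : A.PosDef)
    (t : ℝ) (ht0 : 0 ≤ t) (ht1 : t ≤ 1)
    (X : Matrix (Fin n) (Fin n) ℝ) (hX : X.IsHermitian) :
    MatMajorizedBy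
      (matRPow hA.isHermitian (1 / 2) * X * matRPow hA.isHermitian (1 / 2))
      ((2 : ℝ)⁻¹ • (matRPow hA.isHermitian t * X * matRPow hA.isHermitian (1 - t) +
        matRPow hA.isHermitian (1 - t) * X * matRPow hA.isHermitian t)) ∧
    MatMajorizedBy
      ((2 : ℝ)⁻¹ • (matRPow hA.isHermitian t * X * matRPow hA.isHermitian (1 - t) +
        matRPow hA.isHermitian (1 - t) * X * matRPow hA.isHermitian t))
      ((2 : ℝ)⁻¹ • (A * X + X * A)) := by
  have h1 := MajAux.mean_majorized hA X hX (1 / 2) t 0 (by simp) (by ring)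
  have h2 := MajAux.mean_majorized hA X hX t 1 (2 * t - 1)
    (abs_le.2 ⟨by linarith, by linarith⟩) (by ring)
  refine ⟨?_, ?_⟩
  · convert h1 using 1
    rw [show (1 : ℝ) - 1 / 2 = 1 / 2 by norm_num, ← two_smul ℝ, smul_smul]
    norm_num
  · convert h2 using 1
    rw [sub_self, MajAux.matRPow_zero, MajAux.matRPow_one, mul_one, one_mul]
end
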